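/- Let G be a finite simple graph on n ≥ 3 vertices and m ≥ ⌈n/2⌉ edges which has an isolated vertex. Then there exists a graph H on n vertices and m edges with no isolated vertices such that D(H,x) > D(G,x) for all x > 0. -/

import Mathlib

open scoped Classical

/-- `S` is a dominating set of `G`: every vertex is in `S` or adjacent to a vertex of `S`. -/
def IsDomSet {V : Type*} (G : SimpleGraph V) (S : Finset V) : Prop :=
  ∀ v : V, v ∈ S ∨ ∃ u ∈ S, G.Adj u v

/-- `d(G,i)`: the number of dominating sets of `G` of cardinality `i`. -/
noncomputable def domCount {V : Type*} [Fintype V] (G : SimpleGraph V) (i : ℕ) : ℕ :=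
  (Finset.univ.filter (fun S : Finset V => IsDomSet G S ∧ S.card = i)).card

/-- The domination polynomial `D(G,x) = ∑_{i=1}^{n} d(G,i) x^i`. -/
noncomputable def domPoly {V : Type*} [Fintype V] (G : SimpleGraph V) (x : ℝ) : ℝ :=
  ∑ i ∈ Finset.Icc 1 (Fintype.card V), (domCount G i : ℝ) * x ^ i

/-- The graph obtained from `G` by replacing the edge `uv` with the edge `uw`. -/
def moveEdge {V : Type*} (G : SimpleGraph V) (u v w : V) : SimpleGraph V :=
  G.deleteEdges {s(u, v)} ⊔ SimpleGraph.edge u w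

section MoveEdge

variable {V : Type*} {G : SimpleGraph V} {u v w z : V}

lemma moveEdge_adj {a b : V} (huw : u ≠ w) : (moveEdge G u v w).Adj a b ↔
    (G.Adj a b ∧ ¬ (a = u ∧ b = v) ∧ ¬ (a = v ∧ b = u)) ∨
      (a = u ∧ b = w) ∨ (a = w ∧ b = u) := by
  simp only [moveEdge, SimpleGraph.sup_adj, SimpleGraph.deleteEdges_adj, SimpleGraph.edge_adj,
    Set.mem_singleton_iff, Sym2.eq_iff]
  grind

lemma ncard_edgeSet_moveEdge (huv : G.Adj u v) (hw : ∀ a, ¬ G.Adj w a) :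
    (moveEdge G u v w).edgeSet.ncard = G.edgeSet.ncard := by
  have huw : u ≠ w := by
    rintro rfl
    exact hw _ huv
  have h : (moveEdge G u v w).edgeSet = insert s(u, w) (G.edgeSet \ {s(u, v)}) := by
    rw [moveEdge, SimpleGraph.edgeSet_sup, SimpleGraph.edgeSet_deleteEdges,
      SimpleGraph.edgeSet_edge_of_ne huw, Set.union_singleton]
  rw [h]
  exact Set.ncard_exchange (fun h : G.Adj u w => hw _ h.symm) huv

/-- Being dominated by `S` in `G`. -/
def IsDominatedBy (G : SimpleGraph V) (S : Finset V) (v : V) : Prop :=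
  v ∈ S ∨ ∃ u ∈ S, G.Adj u v

lemma IsDomSet.mem_of_isolated {S : Finset V} (hS : IsDomSet G S) (hw : ∀ a, ¬ G.Adj w a) :
    w ∈ S := by
  rcases hS w with h | ⟨a, -, ha⟩
  · exact h
  · exact (hw _ ha.symm).elim

/-- Sends dominating sets of `G` to dominating sets of `moveEdge G u v w`. -/
noncomputable def moveDomSet (G : SimpleGraph V) (u v w : V) (S : Finset V) : Finset V :=
  if IsDominatedBy (moveEdge G u v w) S v then S else insert v (S.erase w)

lemma isDomSet_moveDomSet {S : Finset V} (huv : G.Adj u v) (hw : ∀ a, ¬ G.Adj w a)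
    (hS : IsDomSet G S) : IsDomSet (moveEdge G u v w) (moveDomSet G u v w S) := by
  have hwS := hS.mem_of_isolated hw
  have huw : u ≠ w := by
    rintro rfl
    exact hw _ huv
  unfold moveDomSet
  split_ifs with hv
  · intro a
    by_cases hau : a = u
    · exact Or.inr ⟨w, hwS, (moveEdge_adj huw).2 (by simp [hau])⟩
    by_cases hav : a = v
    · exact hav ▸ hv
    rcases hS a with h | ⟨b, hb, hba⟩
    · exact Or.inl h
    · exact Or.inr ⟨b, hb, (moveEdge_adj huw).2 (by simp [hba, hau, hav])⟩
  · have huS : u ∈ S := by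
      by_contra hu
      apply hv
      rcases hS v with h | ⟨b, hb, hbv⟩
      · exact Or.inl h
      · refine Or.inr ⟨b, hb, (moveEdge_adj huw).2 (Or.inl ⟨hbv, ?_, ?_⟩)⟩
        · rintro ⟨rfl, -⟩
          exact hu hb
        · rintro ⟨rfl, -⟩
          exact G.irrefl hbv
    intro a
    by_cases hav : a = v
    · simp [hav]
    by_cases haw : a = w
    · exact Or.inr ⟨u, by simp [huS, huw], (moveEdge_adj huw).2 (by simp [haw])⟩
    by_cases hau : a = u
    · left
      simp [hau, huS, huw]
    rcases hS a with h | ⟨b, hb, hba⟩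
    · left
      simp [h, haw]
    · have hbw : b ≠ w := by
        rintro rfl
        exact hw _ hba
      exact Or.inr ⟨b, by simp [hb, hbw], (moveEdge_adj huw).2 (by simp [hba, hau, hav])⟩

lemma card_moveDomSet {S : Finset V} (hwS : w ∈ S) : (moveDomSet G u v w S).card = S.card := by
  unfold moveDomSet
  split_ifs with hv
  · rfl
  · have hvS : v ∉ S := fun h => hv (Or.inl h)
    rw [Finset.card_insert_of_notMem (by simp [hvS]), Finset.card_erase_add_one hwS]

lemma moveDomSet_injOn (hvw : v ≠ w) : Set.InjOn (moveDomSet G u v w) {S | w ∈ S} := by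
  intro S (hS : w ∈ S) T (hT : w ∈ T) h
  unfold moveDomSet at h
  split_ifs at h with h₁ h₂ h₂
  · exact h
  · rw [h] at hS
    simp [hvw.symm] at hS
  · rw [← h] at hT
    simp [hvw.symm] at hT
  · have hvS : v ∉ S := fun h => h₁ (Or.inl h)
    have hvT : v ∉ T := fun h => h₂ (Or.inl h)
    ext a
    have ha := Finset.ext_iff.1 h a
    simp only [Finset.mem_insert, Finset.mem_erase] at ha
    grind

variable [Fintype V]

lemma domCount_le_moveEdge (huv : G.Adj u v) (hw : ∀ a, ¬ G.Adj w a) (i : ℕ) :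
    domCount G i ≤ domCount (moveEdge G u v w) i := by
  have hvw : v ≠ w := by
    rintro rfl
    exact hw _ huv.symm
  refine Finset.card_le_card_of_injOn (moveDomSet G u v w) ?_ ?_
  · intro S hS
    simp only [Finset.coe_filter, Finset.mem_univ, true_and, Set.mem_ofPred_eq] at hS ⊢
    exact ⟨isDomSet_moveDomSet huv hw hS.1,
      (card_moveDomSet (hS.1.mem_of_isolated hw)).trans hS.2⟩
  · refine (moveDomSet_injOn hvw).mono fun S hS => ?_
    simp only [Finset.coe_filter, Finset.mem_univ, true_and, Set.mem_ofPred_eq] at hS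
    exact hS.1.mem_of_isolated hw

lemma domCount_lt_moveEdge (huv : G.Adj u v) (hw : ∀ a, ¬ G.Adj w a) (hvz : G.Adj v z)
    (hzu : z ≠ u) : domCount G (Fintype.card V - 1) <
      domCount (moveEdge G u v w) (Fintype.card V - 1) := by
  have hvw : v ≠ w := by
    rintro rfl
    exact hw _ huv.symm
  have huw : u ≠ w := by
    rintro rfl
    exact hw _ huv
  have hzv : (moveEdge G u v w).Adj z v :=
    (moveEdge_adj huw).2 (Or.inl ⟨hvz.symm, by simp [hzu], by simp [hvz.ne']⟩)
  unfold domCount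
  rw [← Finset.card_image_of_injOn (f := moveDomSet G u v w)
    ((moveDomSet_injOn hvw).mono fun S hS => ?_)]
  · refine Finset.card_lt_card (Finset.ssubset_iff_of_subset ?_ |>.2
      ⟨Finset.univ.erase w, ?_, ?_⟩)
    · intro T hT
      simp only [Finset.mem_image, Finset.mem_filter, Finset.mem_univ, true_and] at hT ⊢
      obtain ⟨S, hS, rfl⟩ := hT
      exact ⟨isDomSet_moveDomSet huv hw hS.1,
        (card_moveDomSet (hS.1.mem_of_isolated hw)).trans hS.2⟩
    · simp only [Finset.mem_filter, Finset.mem_univ, true_and]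
      refine ⟨fun a => ?_, by simp [Finset.card_erase_of_mem]⟩
      by_cases haw : a = w
      · exact Or.inr ⟨u, by simp [huw], (moveEdge_adj huw).2 (by simp [haw])⟩
      · left
        simp [haw]
    · simp only [Finset.mem_image, Finset.mem_filter, Finset.mem_univ, true_and]
      rintro ⟨S, ⟨hS, hcard⟩, h⟩
      have hwS := hS.mem_of_isolated hw
      unfold moveDomSet at h
      split_ifs at h with hv
      · rw [h] at hwS
        simp at hwS
      · have hvS : v ∉ S := fun h => hv (Or.inl h)
        have hzS : z ∉ S := fun h => hv (Or.inr ⟨z, h, hzv⟩)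
        have hzw : z ≠ w := by
          rintro rfl
          exact hw _ hvz.symm
        have hz := Finset.ext_iff.1 h z
        simp [hzS, hzw, hvz.ne'] at hz
  · simp only [Finset.coe_filter, Finset.mem_univ, true_and, Set.mem_ofPred_eq] at hS
    exact hS.1.mem_of_isolated hw

lemma domPoly_lt_moveEdge (huv : G.Adj u v) (hw : ∀ a, ¬ G.Adj w a) (hvz : G.Adj v z)
    (hzu : z ≠ u) {x : ℝ} (hx : 0 < x) : domPoly G x < domPoly (moveEdge G u v w) x := by
  have : Nontrivial V := ⟨u, v, huv.ne⟩
  have hcard : 1 < Fintype.card V := Fintype.one_lt_card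
  refine Finset.sum_lt_sum (fun i _ => ?_)
    ⟨Fintype.card V - 1, Finset.mem_Icc.2 (by omega), ?_⟩
  · have := domCount_le_moveEdge huv hw i
    gcongr
  · have := domCount_lt_moveEdge huv hw hvz hzu
    gcongr

end MoveEdge

/-- A graph with an isolated vertex and at least half as many edges as vertices has a vertex with
two distinct neighbours. -/
lemma exists_adj_adj_ne {V : Type*} [Fintype V] (G : SimpleGraph V) {w : V}
    (hw : ∀ a, ¬ G.Adj w a) (hm : Fintype.card V ≤ 2 * G.edgeFinset.card) :
    ∃ u v z, G.Adj u v ∧ G.Adj v z ∧ z ≠ u := by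
  by_contra! h
  have hdeg : ∀ v, G.degree v ≤ 1 := fun v => by
    rw [← G.card_neighborFinset_eq_degree, Finset.card_le_one]
    intro a ha b hb
    rw [SimpleGraph.mem_neighborFinset] at ha hb
    exact h b v a hb.symm ha
  have hlt : ∑ v, G.degree v < ∑ _v : V, 1 :=
    Finset.sum_lt_sum (fun v _ => hdeg v) ⟨w, Finset.mem_univ w, by
      rw [← G.card_neighborFinset_eq_degree, Nat.lt_one_iff, Finset.card_eq_zero]
      ext a
      simp [hw a]⟩
  rw [G.sum_degrees_eq_twice_card_edges] at hlt
  simp at hlt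
  omega

theorem exists_domPoly_lt_of_isolated {V : Type*} [Fintype V] (G : SimpleGraph V)
    (hm : Fintype.card V ≤ 2 * G.edgeSet.ncard) (hiso : ∃ w, ∀ a, ¬ G.Adj w a) :
    ∃ H : SimpleGraph V, H.edgeSet.ncard = G.edgeSet.ncard ∧ (∀ v, ∃ a, H.Adj v a) ∧
      ∀ x : ℝ, 0 < x → domPoly G x < domPoly H x := by
  induction hk : {w | ∀ a, ¬ G.Adj w a}.ncard using Nat.strong_induction_on generalizing G with
  | _ k ih =>
    obtain ⟨w, hw⟩ := hiso
    obtain ⟨u, v, z, huv, hvz, hzu⟩ := exists_adj_adj_ne G hw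
      (by rwa [← Set.ncard_coe_finset, SimpleGraph.coe_edgeFinset])
    have huw : u ≠ w := by
      rintro rfl
      exact hw _ huv
    have hlt := fun x hx => domPoly_lt_moveEdge huv hw hvz hzu (x := x) hx
    have hedge := ncard_edgeSet_moveEdge huv hw
    by_cases hiso' : ∃ y, ∀ a, ¬ (moveEdge G u v w).Adj y a
    · have hss : {y | ∀ a, ¬ (moveEdge G u v w).Adj y a} ⊂ {y | ∀ a, ¬ G.Adj y a} := by
        refine (Set.ssubset_iff_of_subset fun y hy a hya => ?_).2
          ⟨w, hw, fun h => h u ((moveEdge_adj huw).2 (by simp))⟩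
        by_cases hyu : y = u
        · exact hy w ((moveEdge_adj huw).2 (by simp [hyu]))
        by_cases hyv : y = v
        · subst hyv
          exact hy z ((moveEdge_adj huw).2 (Or.inl ⟨hvz, by simp [hyu], by simp [hzu]⟩))
        · exact hy a ((moveEdge_adj huw).2 (by simp [hya, hyu, hyv]))
      obtain ⟨H, hH, hHiso, hHlt⟩ := ih _ (hk ▸ Set.ncard_lt_ncard hss (Set.toFinite _))
        (moveEdge G u v w) (by rwa [hedge]) hiso' rfl
      exact ⟨H, hH.trans hedge, hHiso, fun x hx => (hlt x hx).trans (hHlt x hx)⟩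
    · push Not at hiso'
      exact ⟨moveEdge G u v w, hedge, hiso', hlt⟩

theorem stmt_2 (n m : ℕ) (hn : 3 ≤ n) (hm : (n + 1) / 2 ≤ m)
    (G : SimpleGraph (Fin n)) (hG : G.edgeFinset.card = m)
    (hiso : ∃ w : Fin n, G.degree w = 0) :
    ∃ H : SimpleGraph (Fin n), H.edgeFinset.card = m ∧
      (∀ v : Fin n, H.degree v ≠ 0) ∧
      ∀ x : ℝ, 0 < x → domPoly G x < domPoly H x := by
  have hedge : ∀ K : SimpleGraph (Fin n), K.edgeFinset.card = K.edgeSet.ncard := fun K => by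
    rw [← Set.ncard_coe_finset, SimpleGraph.coe_edgeFinset]
  have hdeg : ∀ (K : SimpleGraph (Fin n)) (v : Fin n), K.degree v = 0 ↔ ∀ a, ¬ K.Adj v a := by
    intro K v
    rw [← K.card_neighborFinset_eq_degree, Finset.card_eq_zero, Finset.eq_empty_iff_forall_notMem]
    simp only [SimpleGraph.mem_neighborFinset]
  rw [hedge] at hG
  obtain ⟨w, hw⟩ := hiso
  obtain ⟨H, hH, hHiso, hlt⟩ := exists_domPoly_lt_of_isolated G
    (by rw [Fintype.card_fin]; omega) ⟨w, (hdeg G w).1 hw⟩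
  refine ⟨H, (hedge H).trans (hH.trans hG), fun v hv => ?_, hlt⟩
  obtain ⟨a, ha⟩ := hHiso v
  exact (hdeg H v).1 hv a ha
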